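/- Let N, k be positive integers, Ω ⊂ ℝᴺ a bounded open set, I a nonempty index set, and C_F > 0. For each i ∈ I let A_i : Ω̄ × [−1,1] → S(N+1) (symmetric (N+1)×(N+1) matrices), b_i : Ω̄ × [−1,1] → ℝ^{N+1}, c_i, f_i : Ω̄ × [−1,1] → ℝ satisfy |A_i| ≤ C_F, |b_i| ≤ C_F, |f_i| ≤ C_F and c_i ≥ 0 everywhere. Let r ∈ (0,1), let s : ℝᴺ → ℝ be C² with s ≥ 0 on Ω̄ and (Ds(x), 0)·A_i(x,y)·(Ds(x), 0)ᵀ ≥ 1 for all i ∈ I and (x,y) ∈ Ω̄ × [−r, r], let β₀ : ℝᴺ → ℝ and h : ℝᴺ → ℝ be C², and fix Λ > 1. For parameters α > 1, C_D > 0, ε ∈ (0,1), define χ(x) := e^{α s(x)} and ψ(x,y) := C_D + e^{α·max_{Ω̄} s} − χ(x) + β₀(x)·y + αΛ·χ(x)·(y − ε h(x))². Then there exist α₀ > 1 and C_D > 0 such that for every α ≥ α₀ and every ε ∈ (0,1) with εα < 1 and εΛ < 1, one has ψ > 0 on Ω̄ × [−r, r] and, for all i ∈ I and all (x,y) ∈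 Ω̄ × [−ε, ε] ∩ Ω̄ × [−r, r]: −tr(A_i(x,y)·D²ψ(x,y)) − b_i(x,y)·Dψ(x,y) + c_i(x,y)·ψ(x,y) − f_i(x,y) > 0. -/

import Mathlib

open Matrix

/-- Euclidean norm of a vector in `ℝⁿ`. -/
noncomputable def vnorm {n : ℕ} (v : Fin n → ℝ) : ℝ := Real.sqrt (∑ j, v j ^ 2)

/-- Frobenius norm of a real matrix. -/
noncomputable def matnorm {m n : ℕ} (A : Matrix (Fin m) (Fin n) ℝ) : ℝ :=
  Real.sqrt (∑ i, ∑ j, A i j ^ 2)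

/-- Gradient as a vector of partial derivatives. -/
noncomputable def gradv {n : ℕ} (f : (Fin n → ℝ) → ℝ) (x : Fin n → ℝ) : Fin n → ℝ :=
  fun j => fderiv ℝ f x (Pi.single j 1)

/-- Hessian matrix of second partial derivatives. -/
noncomputable def hessv {n : ℕ} (f : (Fin n → ℝ) → ℝ) (x : Fin n → ℝ) :
    Matrix (Fin n) (Fin n) ℝ :=
  Matrix.of fun i j => fderiv ℝ (fun y => fderiv ℝ f y (Pi.single j 1)) x (Pi.single i 1)

/-- The first `N` coordinates of a point of `ℝ^{N+1}`. -/
def xpart {N : ℕ} (u : Fin (N + 1) → ℝ) : Fin N → ℝ := fun j => u j.castSucc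

/-- The last coordinate of a point of `ℝ^{N+1}`. -/
def ypart {N : ℕ} (u : Fin (N + 1) → ℝ) : ℝ := u (Fin.last N)

/-- The supersolution candidate
`ψ(x,y) = C_D + e^{αS} − e^{αs(x)} + β₀(x)·y + αΛ·e^{αs(x)}·(y − εh(x))²`. -/
noncomputable def psiFun {N : ℕ} (s β₀ h : (Fin N → ℝ) → ℝ) (S Λ α C_D ε : ℝ)
    (u : Fin (N + 1) → ℝ) : ℝ :=
  C_D + Real.exp (α * S) - Real.exp (α * s (xpart u)) + β₀ (xpart u) * ypart u
    + α * Λ * Real.exp (α * s (xpart u)) * (ypart u - ε * h (xpart u)) ^ 2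

theorem hasDerivAt_line {n : ℕ} {f : (Fin n → ℝ) → ℝ} {u : Fin n → ℝ}
    (hf : DifferentiableAt ℝ f u) (v : Fin n → ℝ) :
    HasDerivAt (fun t : ℝ => f (u + t • v)) (fderiv ℝ f u v) 0 :=
  hf.hasFDerivAt.hasLineDerivAt v

theorem fderiv_eq_of_hasDerivAt_line {n : ℕ} {f : (Fin n → ℝ) → ℝ} {u v : Fin n → ℝ} {d : ℝ}
    (hf : DifferentiableAt ℝ f u) (hd : HasDerivAt (fun t : ℝ => f (u + t • v)) d 0) :
    fderiv ℝ f u v = d :=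
  (hasDerivAt_line hf v).unique hd

theorem contDiff_gradv {n : ℕ} {f : (Fin n → ℝ) → ℝ} (hf : ContDiff ℝ 2 f) (j : Fin n) :
    ContDiff ℝ 1 (fun u => gradv f u j) :=
  (hf.fderiv_right (m := 1) (by norm_num)).clm_apply contDiff_const

theorem continuous_hessv {n : ℕ} {f : (Fin n → ℝ) → ℝ} (hf : ContDiff ℝ 2 f) (i j : Fin n) :
    Continuous (fun u => hessv f u i j) :=
  ((contDiff_gradv hf j).continuous_fderiv (by norm_num)).clm_apply continuous_const

/-- A `C²` function is bounded on a compact set together with its partial derivatives of order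
at most two. -/
theorem exists_bound_of_contDiff {n : ℕ} {K : Set (Fin n → ℝ)} (hK : IsCompact K)
    {f : (Fin n → ℝ) → ℝ} (hf : ContDiff ℝ 2 f) :
    ∃ G : ℝ, ∀ u ∈ K, |f u| ≤ G ∧ (∀ j, |gradv f u j| ≤ G) ∧ ∀ i j, |hessv f u i j| ≤ G := by
  have hcont : Continuous fun u =>
      |f u| + (∑ j, |gradv f u j|) + ∑ i, ∑ j, |hessv f u i j| := by
    have h1 := hf.continuous
    have h2 := fun j => (contDiff_gradv hf j).continuous
    have h3 := continuous_hessv hf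
    fun_prop
  obtain ⟨G, hG⟩ := hK.exists_bound_of_continuousOn hcont.continuousOn
  refine ⟨G, fun u hu => ?_⟩
  have hle := (le_abs_self _).trans (hG u hu)
  have h1 : 0 ≤ |f u| := abs_nonneg _
  have h2 : 0 ≤ ∑ j, |gradv f u j| := Finset.sum_nonneg fun _ _ => abs_nonneg _
  have h3 : 0 ≤ ∑ i, ∑ j, |hessv f u i j| :=
    Finset.sum_nonneg fun _ _ => Finset.sum_nonneg fun _ _ => abs_nonneg _
  refine ⟨by linarith, fun j => ?_, fun i j => ?_⟩
  · have := Finset.single_le_sum (f := fun j => |gradv f u j|) (fun _ _ => abs_nonneg _)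
      (Finset.mem_univ j)
    exact this.trans (by linarith)
  · have hj := Finset.single_le_sum (f := fun j => |hessv f u i j|) (fun _ _ => abs_nonneg _)
      (Finset.mem_univ j)
    have hi := Finset.single_le_sum (f := fun i => ∑ j, |hessv f u i j|)
      (fun _ _ => Finset.sum_nonneg fun _ _ => abs_nonneg _) (Finset.mem_univ i)
    exact hj.trans (hi.trans (by linarith))

/-- Gradient of `k − e^{ασ} + βy + μe^{ασ}(y − εη)²`. -/
theorem gradv_expBarrier {n : ℕ} {σ β y η : (Fin n → ℝ) → ℝ} (hσ : ContDiff ℝ 2 σ)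
    (hβ : ContDiff ℝ 2 β) (hy : ContDiff ℝ 2 y) (hη : ContDiff ℝ 2 η) (k α μ ε : ℝ)
    (u : Fin n → ℝ) (j : Fin n) :
    gradv (fun u => k - Real.exp (α * σ u) + β u * y u
        + μ * Real.exp (α * σ u) * (y u - ε * η u) ^ 2) u j =
      -(α * Real.exp (α * σ u) * gradv σ u j) + gradv β u j * y u + β u * gradv y u j
        + μ * Real.exp (α * σ u) * (α * gradv σ u j * (y u - ε * η u) ^ 2
          + 2 * (y u - ε * η u) * (gradv y u j - ε * gradv η u j)) := by
  have dσ := hσ.differentiable (by norm_num)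
  have dβ := hβ.differentiable (by norm_num)
  have dy := hy.differentiable (by norm_num)
  have dη := hη.differentiable (by norm_num)
  have lσ := hasDerivAt_line (dσ u) (Pi.single j 1)
  have lβ := hasDerivAt_line (dβ u) (Pi.single j 1)
  have ly := hasDerivAt_line (dy u) (Pi.single j 1)
  have lη := hasDerivAt_line (dη u) (Pi.single j 1)
  have lχ := (lσ.const_mul α).exp
  refine fderiv_eq_of_hasDerivAt_line (by fun_prop) ?_
  refine ((((hasDerivAt_const (0 : ℝ) k).sub lχ).add (lβ.mul ly)).add
    ((lχ.const_mul μ).mul ((ly.sub (lη.const_mul ε)).pow 2))).congr_deriv ?_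
  simp only [gradv, zero_smul, add_zero, Pi.sub_apply, Pi.pow_apply]
  norm_num
  ring

/-- Hessian of `k − e^{ασ} + βy + μe^{ασ}(y − εη)²`. -/
theorem hessv_expBarrier {n : ℕ} {σ β y η : (Fin n → ℝ) → ℝ} (hσ : ContDiff ℝ 2 σ)
    (hβ : ContDiff ℝ 2 β) (hy : ContDiff ℝ 2 y) (hη : ContDiff ℝ 2 η) (k α μ ε : ℝ)
    (u : Fin n → ℝ) (i j : Fin n) :
    hessv (fun u => k - Real.exp (α * σ u) + β u * y u
        + μ * Real.exp (α * σ u) * (y u - ε * η u) ^ 2) u i j =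
      -(α * Real.exp (α * σ u) * (α * gradv σ u i * gradv σ u j + hessv σ u i j))
        + (hessv β u i j * y u + gradv β u j * gradv y u i + gradv β u i * gradv y u j
          + β u * hessv y u i j)
        + μ * Real.exp (α * σ u) * (
          α * gradv σ u i * (α * gradv σ u j * (y u - ε * η u) ^ 2
            + 2 * (y u - ε * η u) * (gradv y u j - ε * gradv η u j))
          + α * hessv σ u i j * (y u - ε * η u) ^ 2
          + 2 * α * gradv σ u j * (y u - ε * η u) * (gradv y u i - ε * gradv η u i)
          + 2 * (gradv y u i - ε * gradv η u i) * (gradv y u j - ε * gradv η u j)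
          + 2 * (y u - ε * η u) * (hessv y u i j - ε * hessv η u i j)) := by
  have dσ := hσ.differentiable (by norm_num)
  have dβ := hβ.differentiable (by norm_num)
  have dy := hy.differentiable (by norm_num)
  have dη := hη.differentiable (by norm_num)
  have gσ := (contDiff_gradv hσ j).differentiable (by norm_num)
  have gβ := (contDiff_gradv hβ j).differentiable (by norm_num)
  have gy := (contDiff_gradv hy j).differentiable (by norm_num)
  have gη := (contDiff_gradv hη j).differentiable (by norm_num)
  have lσ := hasDerivAt_line (dσ u) (Pi.single i 1)
  have lβ := hasDerivAt_line (dβ u) (Pi.single i 1)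
  have ly := hasDerivAt_line (dy u) (Pi.single i 1)
  have lη := hasDerivAt_line (dη u) (Pi.single i 1)
  have mσ := hasDerivAt_line (gσ u) (Pi.single i 1)
  have mβ := hasDerivAt_line (gβ u) (Pi.single i 1)
  have my := hasDerivAt_line (gy u) (Pi.single i 1)
  have mη := hasDerivAt_line (gη u) (Pi.single i 1)
  have lχ := (lσ.const_mul α).exp
  have le := ly.sub (lη.const_mul ε)
  change fderiv ℝ (fun w => gradv (fun u => k - Real.exp (α * σ u) + β u * y u
        + μ * Real.exp (α * σ u) * (y u - ε * η u) ^ 2) w j) u (Pi.single i 1) = _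
  rw [funext fun w => gradv_expBarrier hσ hβ hy hη k α μ ε w j]
  refine fderiv_eq_of_hasDerivAt_line (by fun_prop) ?_
  refine ((((((lχ.const_mul α).mul mσ).neg).add (mβ.mul ly)).add (lβ.mul my)).add
    ((lχ.const_mul μ).mul (((mσ.const_mul α).mul (le.pow 2)).add
      ((le.const_mul 2).mul (my.sub (mη.const_mul ε)))))).congr_deriv ?_
  simp only [gradv, hessv, of_apply, zero_smul, add_zero]
  norm_num
  ring

theorem abs_apply_le_vnorm {n : ℕ} (v : Fin n → ℝ) (j : Fin n) : |v j| ≤ vnorm v :=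
  Real.abs_le_sqrt (Finset.single_le_sum (f := fun j => v j ^ 2) (fun _ _ => sq_nonneg _)
    (Finset.mem_univ j))

theorem abs_apply_le_matnorm {m n : ℕ} (A : Matrix (Fin m) (Fin n) ℝ) (i : Fin m) (j : Fin n) :
    |A i j| ≤ matnorm A :=
  Real.abs_le_sqrt ((Finset.single_le_sum (f := fun j => A i j ^ 2) (fun _ _ => sq_nonneg _)
    (Finset.mem_univ j)).trans (Finset.single_le_sum (f := fun i => ∑ j, A i j ^ 2)
    (fun _ _ => Finset.sum_nonneg fun _ _ => sq_nonneg _) (Finset.mem_univ i)))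

theorem abs_dotProduct_le {n : ℕ} {v w : Fin n → ℝ} {C D : ℝ} (hC : 0 ≤ C)
    (hv : ∀ j, |v j| ≤ C) (hw : ∀ j, |w j| ≤ D) : |dotProduct v w| ≤ n * (C * D) := by
  refine (Finset.abs_sum_le_sum_abs _ _).trans ?_
  refine (Finset.sum_le_card_nsmul _ _ (C * D) fun j _ => ?_).trans (by simp)
  rw [abs_mul]
  exact mul_le_mul (hv j) (hw j) (abs_nonneg _) hC

theorem abs_trace_mul_le {n : ℕ} {A M : Matrix (Fin n) (Fin n) ℝ} {C D : ℝ} (hC : 0 ≤ C)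
    (hA : ∀ i j, |A i j| ≤ C) (hM : ∀ i j, |M i j| ≤ D) :
    |trace (A * M)| ≤ n * (n * (C * D)) := by
  refine (Finset.abs_sum_le_sum_abs _ _).trans ?_
  refine (Finset.sum_le_card_nsmul _ _ (n * (C * D)) fun i _ => ?_).trans (by simp)
  exact abs_dotProduct_le hC (hA i) fun j => hM j i

theorem trace_mul_vecMulVec_self {n : ℕ} (A : Matrix (Fin n) (Fin n) ℝ) (p : Fin n → ℝ) :
    trace (A * vecMulVec p p) = dotProduct (vecMul p A) p := by
  rw [mul_vecMulVec, trace_vecMulVec, dotProduct_comm, dotProduct_mulVec]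

theorem gradv_comp_xpart {N : ℕ} {s : (Fin N → ℝ) → ℝ} (hs : Differentiable ℝ s)
    (x : Fin N → ℝ) (y : ℝ) :
    gradv (fun u : Fin (N + 1) → ℝ => s (xpart u)) (Fin.snoc x y : Fin (N + 1) → ℝ)
      = (Fin.snoc (gradv s x) 0 : Fin (N + 1) → ℝ) := by
  let L : (Fin (N + 1) → ℝ) →L[ℝ] (Fin N → ℝ) :=
    ContinuousLinearMap.pi fun j => ContinuousLinearMap.proj j.castSucc
  have hL : ∀ u, L u = xpart u := fun u => rfl
  have hx : L (Fin.snoc x y : Fin (N + 1) → ℝ) = x := by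
    ext j; simp [L]
  have hd : HasFDerivAt (fun u : Fin (N + 1) → ℝ => s (xpart u)) ((fderiv ℝ s x).comp L)
      (Fin.snoc x y : Fin (N + 1) → ℝ) := by
    refine HasFDerivAt.comp (g := s) _ ?_ L.hasFDerivAt
    change HasFDerivAt s (fderiv ℝ s x) (L (Fin.snoc x y : Fin (N + 1) → ℝ))
    rw [hx]; exact (hs x).hasFDerivAt
  ext j
  rw [gradv, hd.fderiv, ContinuousLinearMap.comp_apply, hL]
  refine Fin.lastCases ?_ (fun j => ?_) j
  · have : xpart (Pi.single (Fin.last N) (1 : ℝ)) = 0 := by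
      ext k; simp [xpart, Fin.castSucc_ne_last]
    simp [this]
  · have : xpart (Pi.single j.castSucc (1 : ℝ)) = Pi.single j 1 := by
      ext k; simp [xpart, Pi.single_apply]
    simp [this, gradv]

theorem abs_mul_le_mul {a b A B : ℝ} (ha : |a| ≤ A) (hb : |b| ≤ B) : |a * b| ≤ A * B := by
  rw [abs_mul]
  exact mul_le_mul ha hb (abs_nonneg _) ((abs_nonneg _).trans ha)

theorem abs_gradv_remainder_le {G Λ α X σ' β β' y y' e e' : ℝ} (hΛ : 0 ≤ Λ)
    (hα : 1 ≤ α) (hX : 1 ≤ X) (hσ' : |σ'| ≤ G) (hβ : |β| ≤ G) (hβ' : |β'| ≤ G)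
    (hy : |y| ≤ G) (hy' : |y'| ≤ G) (he : |e| ≤ 1 + G) (hαe : |α * e| ≤ 1 + G)
    (he' : |e'| ≤ 2 * G) :
    |-(α * X * σ') + β' * y + β * y' + α * Λ * X * (α * σ' * e ^ 2 + 2 * e * e')| ≤
      α * X * (G + 2 * G ^ 2 + Λ * (G * (1 + G) ^ 2 + 4 * (1 + G) * G)) := by
  have hαX : 1 ≤ α * X := one_le_mul_of_one_le_of_one_le hα hX
  have h1 := abs_le.1 (abs_mul_le_mul hβ' hy)
  have h2 := abs_le.1 (abs_mul_le_mul hβ hy')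
  have h3 := abs_le.1 (abs_mul_le_mul hσ' (abs_mul_le_mul hαe he))
  have h4 := abs_le.1 (abs_mul_le_mul he he')
  have hσ := abs_le.1 hσ'
  have hZ : |-σ' + Λ * (σ' * (α * e * e) + 2 * (e * e'))| ≤
      G + Λ * (G * (1 + G) ^ 2 + 4 * (1 + G) * G) := by
    have : |Λ * (σ' * (α * e * e) + 2 * (e * e'))| ≤
        Λ * (G * (1 + G) ^ 2 + 4 * (1 + G) * G) := by
      rw [abs_mul, abs_of_nonneg hΛ]
      exact mul_le_mul_of_nonneg_left (abs_le.2 ⟨by linarith, by linarith⟩) hΛ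
    have := abs_le.1 this
    exact abs_le.2 ⟨by linarith, by linarith⟩
  have hZ' := abs_le.1 (abs_mul_le_mul (abs_of_nonneg (zero_le_one.trans hαX)).le hZ)
  have hT : G ^ 2 ≤ α * X * G ^ 2 := le_mul_of_one_le_left (sq_nonneg _) hαX
  exact abs_le.2 ⟨by linarith, by linarith⟩

theorem abs_hessv_remainder_le {G Λ α X σi σj σij β βi βj βij y yi yj yij e ei ej eij : ℝ}
    (hΛ : 0 ≤ Λ) (hα : 1 ≤ α) (hX : 1 ≤ X)
    (hσi : |σi| ≤ G) (hσj : |σj| ≤ G) (hσij : |σij| ≤ G)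
    (hβ : |β| ≤ G) (hβi : |βi| ≤ G) (hβj : |βj| ≤ G) (hβij : |βij| ≤ G)
    (hy : |y| ≤ G) (hyi : |yi| ≤ G) (hyj : |yj| ≤ G) (hyij : |yij| ≤ G)
    (he : |e| ≤ 1 + G) (hαe : |α * e| ≤ 1 + G)
    (hei : |ei| ≤ 2 * G) (hej : |ej| ≤ 2 * G) (heij : |eij| ≤ 2 * G) :
    |-(α * X * σij) + (βij * y + βj * yi + βi * yj + β * yij)
        + α * Λ * X * (2 * α * e * (σi * ej + σj * ei) + α * σij * e ^ 2 + 2 * ei * ej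
          + 2 * e * eij)| ≤
      α * X * (G + 4 * G ^ 2 + Λ * (8 * (1 + G) * G ^ 2 + G * (1 + G) ^ 2 + 8 * G ^ 2
        + 4 * (1 + G) * G)) := by
  have hαX : 1 ≤ α * X := one_le_mul_of_one_le_of_one_le hα hX
  have h1 := abs_le.1 (abs_mul_le_mul hβij hy)
  have h2 := abs_le.1 (abs_mul_le_mul hβj hyi)
  have h3 := abs_le.1 (abs_mul_le_mul hβi hyj)
  have h4 := abs_le.1 (abs_mul_le_mul hβ hyij)
  have h5 := abs_le.1 (abs_mul_le_mul hαe (abs_mul_le_mul hσi hej))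
  have h6 := abs_le.1 (abs_mul_le_mul hαe (abs_mul_le_mul hσj hei))
  have h7 := abs_le.1 (abs_mul_le_mul hσij (abs_mul_le_mul hαe he))
  have h8 := abs_le.1 (abs_mul_le_mul hei hej)
  have h9 := abs_le.1 (abs_mul_le_mul he heij)
  have hσ := abs_le.1 hσij
  have hZ : |-σij + Λ * (2 * (α * e * (σi * ej)) + 2 * (α * e * (σj * ei)) + σij * (α * e * e)
        + 2 * (ei * ej) + 2 * (e * eij))| ≤
      G + Λ * (8 * (1 + G) * G ^ 2 + G * (1 + G) ^ 2 + 8 * G ^ 2 + 4 * (1 + G) * G) := by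
    have : |Λ * (2 * (α * e * (σi * ej)) + 2 * (α * e * (σj * ei)) + σij * (α * e * e)
          + 2 * (ei * ej) + 2 * (e * eij))| ≤
        Λ * (8 * (1 + G) * G ^ 2 + G * (1 + G) ^ 2 + 8 * G ^ 2 + 4 * (1 + G) * G) := by
      rw [abs_mul, abs_of_nonneg hΛ]
      exact mul_le_mul_of_nonneg_left (abs_le.2 ⟨by linarith, by linarith⟩) hΛ
    have := abs_le.1 this
    exact abs_le.2 ⟨by linarith, by linarith⟩
  have hZ' := abs_le.1 (abs_mul_le_mul (abs_of_nonneg (zero_le_one.trans hαX)).le hZ)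
  have hT : G ^ 2 ≤ α * X * G ^ 2 := le_mul_of_one_le_left (sq_nonneg _) hαX
  exact abs_le.2 ⟨by linarith, by linarith⟩

/-- Pointwise supersolution inequality for `k − e^{ασ} + βy + αΛe^{ασ}(y − εη)²`, with `α` large
depending only on the bounds for the data. -/
theorem expBarrier_supersolution {n : ℕ} {σ β y η : (Fin n → ℝ) → ℝ} (hσ : ContDiff ℝ 2 σ)
    (hβ : ContDiff ℝ 2 β) (hy : ContDiff ℝ 2 y) (hη : ContDiff ℝ 2 η) {k α Λ ε G C K : ℝ}
    {u : Fin n → ℝ} {A : Matrix (Fin n) (Fin n) ℝ} {b : Fin n → ℝ} {z f : ℝ}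
    (hC : 0 ≤ C) (hG : 1 ≤ G) (hΛ : 1 ≤ Λ) (hε : 0 < ε) (hε1 : ε < 1) (hεα : ε * α < 1)
    (hK : K = G + 4 * G ^ 2 + Λ * (8 * (1 + G) * G ^ 2 + G * (1 + G) ^ 2 + 8 * G ^ 2
        + 4 * (1 + G) * G))
    (hα : 2 * Λ * (1 + G) ^ 2 ≤ α)
    (hα' : 2 * (n * (n * (C * K)) + n * (C * K) + C) + 1 ≤ α)
    (hA : ∀ i j, |A i j| ≤ C) (hb : ∀ j, |b j| ≤ C) (hf : |f| ≤ C) (hz : 0 ≤ z)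
    (hell : 1 ≤ dotProduct (vecMul (gradv σ u) A) (gradv σ u))
    (hσ0 : 0 ≤ σ u) (hyε : |y u| ≤ ε)
    (bσ : (∀ j, |gradv σ u j| ≤ G) ∧ ∀ i j, |hessv σ u i j| ≤ G)
    (bβ : |β u| ≤ G ∧ (∀ j, |gradv β u j| ≤ G) ∧ ∀ i j, |hessv β u i j| ≤ G)
    (bY : |y u| ≤ G ∧ (∀ j, |gradv y u j| ≤ G) ∧ ∀ i j, |hessv y u i j| ≤ G)
    (bη : |η u| ≤ G ∧ (∀ j, |gradv η u j| ≤ G) ∧ ∀ i j, |hessv η u i j| ≤ G) :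
    0 < -(trace (A * hessv (fun u => k - Real.exp (α * σ u) + β u * y u
            + α * Λ * Real.exp (α * σ u) * (y u - ε * η u) ^ 2) u))
        - dotProduct b (gradv (fun u => k - Real.exp (α * σ u) + β u * y u
            + α * Λ * Real.exp (α * σ u) * (y u - ε * η u) ^ 2) u)
        + z - f := by
  have hG0 : 0 ≤ G := by linarith
  have hα1 : 1 ≤ α := by nlinarith
  have hα0 : 0 < α := by linarith
  have hX : 1 ≤ Real.exp (α * σ u) := Real.one_le_exp (mul_nonneg hα0.le hσ0)
  set X := Real.exp (α * σ u) with hXdef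
  set e := y u - ε * η u with hedef
  have hdiff : ∀ {a c : ℝ}, |a| ≤ G → |c| ≤ G → |a - ε * c| ≤ 2 * G := fun {a c} ha hc => by
    have h1 := abs_mul_le_mul (abs_of_pos hε).le hc
    have h2 : ε * G ≤ G := mul_le_of_le_one_left hG0 hε1.le
    have := abs_sub a (ε * c)
    linarith
  have heε : |e| ≤ ε * (1 + G) := by
    have h1 := abs_mul_le_mul (abs_of_pos hε).le bη.1
    have := abs_sub (y u) (ε * η u)
    linarith
  have he : |e| ≤ 1 + G := heε.trans (mul_le_of_le_one_left (by linarith) hε1.le)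
  have hαe : |α * e| ≤ 1 + G := by
    refine (abs_mul_le_mul (abs_of_pos hα0).le heε).trans ?_
    rw [← mul_assoc, mul_comm α]
    exact mul_le_of_le_one_left (by linarith) hεα.le
  have hαe2 : α * Λ * e ^ 2 ≤ 1 / 2 := by
    have h1 : (α * e) ^ 2 ≤ (1 + G) ^ 2 := sq_le_sq' (abs_le.1 hαe).1 (abs_le.1 hαe).2
    have h2 : α * (α * Λ * e ^ 2) ≤ α * (1 / 2) := by nlinarith
    exact le_of_mul_le_mul_left h2 hα0
  have hgrad : ∀ j, |gradv (fun u => k - Real.exp (α * σ u) + β u * y u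
      + α * Λ * Real.exp (α * σ u) * (y u - ε * η u) ^ 2) u j| ≤ α * X * K := fun j => by
    rw [gradv_expBarrier hσ hβ hy hη]
    refine (abs_gradv_remainder_le (by linarith) hα1 hX (bσ.1 j) bβ.1 (bβ.2.1 j) bY.1
      (bY.2.1 j) he hαe (hdiff (bY.2.1 j) (bη.2.1 j))).trans ?_
    refine mul_le_mul_of_nonneg_left ?_ (by positivity)
    have : 0 ≤ Λ * (8 * (1 + G) * G ^ 2 + 8 * G ^ 2) := by positivity
    nlinarith
  obtain ⟨R, hR, hH⟩ : ∃ R : Matrix (Fin n) (Fin n) ℝ, (∀ i j, |R i j| ≤ α * X * K) ∧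
      hessv (fun u => k - Real.exp (α * σ u) + β u * y u
        + α * Λ * Real.exp (α * σ u) * (y u - ε * η u) ^ 2) u =
      (α ^ 2 * X * (α * Λ * e ^ 2 - 1)) • vecMulVec (gradv σ u) (gradv σ u) + R := by
    refine ⟨_, fun i j => ?_, (add_sub_cancel _ _).symm⟩
    rw [Matrix.sub_apply, hessv_expBarrier hσ hβ hy hη, Matrix.smul_apply, vecMulVec_apply, hK]
    refine le_of_eq_of_le (congrArg _ ?_) (abs_hessv_remainder_le (by linarith) hα1 hX
      (bσ.1 i) (bσ.1 j) (bσ.2 i j) bβ.1 (bβ.2.1 i) (bβ.2.1 j) (bβ.2.2 i j) bY.1 (bY.2.1 i)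
      (bY.2.1 j) (bY.2.2 i j) he hαe (hdiff (bY.2.1 i) (bη.2.1 i))
      (hdiff (bY.2.1 j) (bη.2.1 j)) (hdiff (bY.2.2 i j) (bη.2.2 i j)))
    rw [← hXdef, ← hedef, smul_eq_mul]
    ring
  have htr := abs_le.1 (abs_trace_mul_le hC hA hR)
  have hdr := abs_le.1 (abs_dotProduct_le hC hb hgrad)
  rw [hH, mul_add, trace_add, mul_smul_comm, trace_smul, trace_mul_vecMulVec_self, smul_eq_mul]
  set Q := dotProduct (vecMul (gradv σ u) A) (gradv σ u)
  have hαX : 1 ≤ α * X := one_le_mul_of_one_le_of_one_le hα1 hX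
  have hmain : α ^ 2 * X * (1 / 2) ≤ α ^ 2 * X * ((1 - α * Λ * e ^ 2) * Q) := by
    refine mul_le_mul_of_nonneg_left ?_ (by positivity)
    nlinarith
  have hlarge := mul_le_mul_of_nonneg_left hα' (zero_le_one.trans hαX)
  have hCX : C ≤ α * X * C := le_mul_of_one_le_left hC hαX
  have hf' := (abs_le.1 hf).2
  linarith


/-- the interior strict supersolution estimate of Step 1 (case `γ₀ = 0`). -/
theorem stmt14 (N k : ℕ) (hN : 0 < N) (hk : 0 < k)
    (Ω : Set (Fin N → ℝ)) (hΩo : IsOpen Ω) (hΩb : Bornology.IsBounded Ω)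
    (I : Type*) [Nonempty I] (C_F : ℝ) (hCF : 0 < C_F)
    (A : I → (Fin N → ℝ) → ℝ → Matrix (Fin (N + 1)) (Fin (N + 1)) ℝ)
    (b : I → (Fin N → ℝ) → ℝ → (Fin (N + 1) → ℝ))
    (c f : I → (Fin N → ℝ) → ℝ → ℝ)
    (hAsym : ∀ i, ∀ x ∈ closure Ω, ∀ y ∈ Set.Icc (-1 : ℝ) 1, (A i x y).IsSymm)
    (hAb : ∀ i, ∀ x ∈ closure Ω, ∀ y ∈ Set.Icc (-1 : ℝ) 1, matnorm (A i x y) ≤ C_F)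
    (hbb : ∀ i, ∀ x ∈ closure Ω, ∀ y ∈ Set.Icc (-1 : ℝ) 1, vnorm (b i x y) ≤ C_F)
    (hfb : ∀ i, ∀ x ∈ closure Ω, ∀ y ∈ Set.Icc (-1 : ℝ) 1, |f i x y| ≤ C_F)
    (hc : ∀ i, ∀ x ∈ closure Ω, ∀ y ∈ Set.Icc (-1 : ℝ) 1, 0 ≤ c i x y)
    (r : ℝ) (hr : r ∈ Set.Ioo (0 : ℝ) 1)
    (s : (Fin N → ℝ) → ℝ) (hs : ContDiff ℝ 2 s) (hs0 : ∀ x ∈ closure Ω, 0 ≤ s x)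
    (hell : ∀ i, ∀ x ∈ closure Ω, ∀ y ∈ Set.Icc (-r) r,
      1 ≤ dotProduct (vecMul (Fin.snoc (gradv s x) 0) (A i x y)) (Fin.snoc (gradv s x) 0))
    (β₀ h : (Fin N → ℝ) → ℝ) (hβ₀ : ContDiff ℝ 2 β₀) (hh : ContDiff ℝ 2 h)
    (Λ : ℝ) (hΛ : 1 < Λ) :
    ∃ α₀ : ℝ, 1 < α₀ ∧ ∃ C_D : ℝ, 0 < C_D ∧
      ∀ α : ℝ, α₀ ≤ α → ∀ ε : ℝ, 0 < ε → ε < 1 → ε * α < 1 → ε * Λ < 1 →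
        (∀ x ∈ closure Ω, ∀ y ∈ Set.Icc (-r) r,
          0 < psiFun s β₀ h (sSup (s '' closure Ω)) Λ α C_D ε (Fin.snoc x y)) ∧
        (∀ i, ∀ x ∈ closure Ω, ∀ y ∈ Set.Icc (-ε) ε ∩ Set.Icc (-r) r,
          0 < -(trace (A i x y *
                  hessv (psiFun s β₀ h (sSup (s '' closure Ω)) Λ α C_D ε) (Fin.snoc x y)))
              - dotProduct (b i x y)
                  (gradv (psiFun s β₀ h (sSup (s '' closure Ω)) Λ α C_D ε) (Fin.snoc x y))
              + c i x y * psiFun s β₀ h (sSup (s '' closure Ω)) Λ α C_D ε (Fin.snoc x y)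
              - f i x y) := by
  let K : Set (Fin (N + 1) → ℝ) :=
    (fun q : (Fin N → ℝ) × ℝ => (Fin.snoc q.1 q.2 : Fin (N + 1) → ℝ)) ''
      (closure Ω ×ˢ Set.Icc (-1 : ℝ) 1)
  have hKc : IsCompact K := by
    refine (hΩb.isCompact_closure.prod isCompact_Icc).image ?_
    refine continuous_pi fun j => ?_
    refine Fin.lastCases ?_ (fun j => ?_) j
    · simpa using continuous_snd
    · simp only [Fin.snoc_castSucc]
      fun_prop
  have hxp : ContDiff ℝ 2 (xpart : (Fin (N + 1) → ℝ) → (Fin N → ℝ)) :=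
    contDiff_pi.2 fun j => contDiff_apply ℝ ℝ j.castSucc
  have hyp : ContDiff ℝ 2 (ypart : (Fin (N + 1) → ℝ) → ℝ) := contDiff_apply ℝ ℝ (Fin.last N)
  have hσ : ContDiff ℝ 2 fun u : Fin (N + 1) → ℝ => s (xpart u) := hs.comp hxp
  have hβ : ContDiff ℝ 2 fun u : Fin (N + 1) → ℝ => β₀ (xpart u) := hβ₀.comp hxp
  have hη : ContDiff ℝ 2 fun u : Fin (N + 1) → ℝ => h (xpart u) := hh.comp hxp
  obtain ⟨G₁, hG₁⟩ := exists_bound_of_contDiff hKc hσ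
  obtain ⟨G₂, hG₂⟩ := exists_bound_of_contDiff hKc hβ
  obtain ⟨G₃, hG₃⟩ := exists_bound_of_contDiff hKc hyp
  obtain ⟨G₄, hG₄⟩ := exists_bound_of_contDiff hKc hη
  obtain ⟨G, hG, h1, h2, h3, h4⟩ : ∃ G : ℝ, 1 ≤ G ∧ G₁ ≤ G ∧ G₂ ≤ G ∧ G₃ ≤ G ∧ G₄ ≤ G :=
    ⟨max 1 (max G₁ (max G₂ (max G₃ G₄))), by simp, by simp, by simp, by simp, by simp⟩
  have hmem : ∀ x ∈ closure Ω, ∀ y ∈ Set.Icc (-1 : ℝ) 1,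
      (Fin.snoc x y : Fin (N + 1) → ℝ) ∈ K := fun x hx y hy => ⟨(x, y), ⟨hx, hy⟩, rfl⟩
  have hB : ∀ {F : (Fin (N + 1) → ℝ) → ℝ} {G' : ℝ}, G' ≤ G →
      (∀ u ∈ K, |F u| ≤ G' ∧ (∀ j, |gradv F u j| ≤ G') ∧ ∀ i j, |hessv F u i j| ≤ G') →
      ∀ u ∈ K, |F u| ≤ G ∧ (∀ j, |gradv F u j| ≤ G) ∧ ∀ i j, |hessv F u i j| ≤ G :=
    fun hle hF u hu => ⟨(hF u hu).1.trans hle, fun j => ((hF u hu).2.1 j).trans hle,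
      fun i j => ((hF u hu).2.2 i j).trans hle⟩
  have hxs : ∀ (x : Fin N → ℝ) (y : ℝ), xpart (Fin.snoc x y : Fin (N + 1) → ℝ) = x :=
    fun x y => by ext j; simp [xpart]
  have hys : ∀ (x : Fin N → ℝ) (y : ℝ), ypart (Fin.snoc x y : Fin (N + 1) → ℝ) = y :=
    fun x y => by simp [ypart]
  have hsub : ∀ y ∈ Set.Icc (-r) r, y ∈ Set.Icc (-1 : ℝ) 1 := fun y hy =>
    ⟨by linarith [hy.1, hr.2], by linarith [hy.2, hr.2]⟩
  obtain ⟨M, hM⟩ : ∃ M : ℝ, M = G + 4 * G ^ 2 + Λ * (8 * (1 + G) * G ^ 2 + G * (1 + G) ^ 2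
      + 8 * G ^ 2 + 4 * (1 + G) * G) := ⟨_, rfl⟩
  refine ⟨max 2 (max (2 * Λ * (1 + G) ^ 2)
    (2 * ((N + 1 : ℕ) * ((N + 1 : ℕ) * (C_F * M)) + (N + 1 : ℕ) * (C_F * M) + C_F) + 1)),
    lt_max_of_lt_left one_lt_two, G + 1, by linarith, fun α hα ε hε hε1 hεα _ => ?_⟩
  obtain ⟨hα2, hα3, hα4⟩ : _ ∧ _ ∧ _ := by simpa only [max_le_iff] using hα
  have hpos : ∀ x ∈ closure Ω, ∀ y ∈ Set.Icc (-r) r,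
      0 < psiFun s β₀ h (sSup (s '' closure Ω)) Λ α (G + 1) ε (Fin.snoc x y) := by
    intro x hx y hy
    have hβG := (hG₂ _ (hmem x hx y (hsub y hy))).1.trans h2
    have hy1 := abs_le.2 (hsub y hy)
    have hsS : s x ≤ sSup (s '' closure Ω) :=
      le_csSup (hΩb.isCompact_closure.image hs.continuous).bddAbove ⟨x, hx, rfl⟩
    have hexp := Real.exp_le_exp.2 (mul_le_mul_of_nonneg_left hsS (by linarith : 0 ≤ α))
    simp only [psiFun, hxs, hys] at hβG ⊢
    have hβy := (abs_le.1 (abs_mul_le_mul hβG hy1)).1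
    have : 0 ≤ α * Λ * Real.exp (α * s x) * (y - ε * h x) ^ 2 := by positivity
    linarith
  refine ⟨hpos, fun i x hx y hy => ?_⟩
  have hy1 := hsub y hy.2
  have hu := hmem x hx y hy1
  refine expBarrier_supersolution (C := C_F) hσ hβ hyp hη hCF.le hG hΛ.le hε hε1 hεα hM hα3 hα4
    (fun j l => (abs_apply_le_matnorm _ j l).trans (hAb i x hx y hy1))
    (fun j => (abs_apply_le_vnorm _ j).trans (hbb i x hx y hy1)) (hfb i x hx y hy1)
    (mul_nonneg (hc i x hx y hy1) (hpos x hx y hy.2).le) ?_ ?_ ?_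
    (hB h1 hG₁ _ hu).2 (hB h2 hG₂ _ hu) (hB h3 hG₃ _ hu)
    (hB h4 hG₄ _ hu)
  · rw [gradv_comp_xpart (hs.differentiable (by norm_num))]
    exact hell i x hx y hy.2
  · rw [hxs]; exact hs0 x hx
  · rw [hys]; exact abs_le.2 hy.1
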